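/- Let K be a complex vector space carrying two inner products ⟨·,·⟩₁ and ⟨·,·⟩₂, each making K a Hilbert space, whose norms are equivalent: α‖f‖₁ ≤ ‖f‖₂ ≤ β‖f‖₁ for some 0 < α ≤ β and all f ∈ K. For i = 1, 2 let P_i be a bounded idempotent operator on K that is self-adjoint with respect to ⟨·,·⟩_i, and assume P₁ − P₂ is a Hilbert–Schmidt operator. Let ‖·‖_i and ‖·‖_{HS,i} denote the operator norm and Hilbert–Schmidt norm with respect to ⟨·,·⟩_i, and set d_{P_i}(A,B) := ‖A − B‖_i + ‖P_i (A − B)(1 − P_i)‖_{HS,i}. Then there exist constants 0 < m ≤ M such that m · d_{P₁}(A,B) ≤ d_{P₂}(A,B) ≤ M · d_{P₁}(A,B) for all bounded operators A, B on K (as an inequality in [0,∞]). In particular, for a bounded operator U, P₁U(1−P₁) is Hilbert–Schmidt if and only if P₂U(1−P₂) is Hilbert–Schmidt, so the groups Sp(∞,P₁) and Sp(∞,P₂) coincide as topological groups. -/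

import Mathlib

open scoped ENNReal

/-- The Hilbert–Schmidt norm of an operator, computed with respect to a Hilbert basis
`b` (the value is independent of the choice of basis). -/
noncomputable def hsNorm {E : Type*} [NormedAddCommGroup E] [InnerProductSpace ℂ E]
    [CompleteSpace E] {ι : Type*} (b : HilbertBasis ι ℂ E) (T : E →L[ℂ] E) : ℝ≥0∞ :=
  (∑' i : ι, (‖T (b i)‖₊ : ℝ≥0∞) ^ 2) ^ (1 / 2 : ℝ)

/-- The distance `d_P(A,B) = ‖A - B‖ + ‖P (A - B) (1 - P)‖_HS`. -/
noncomputable def dP {E : Type*} [NormedAddCommGroup E] [InnerProductSpace ℂ E]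
    [CompleteSpace E] {ι : Type*} (b : HilbertBasis ι ℂ E) (P : E →L[ℂ] E)
    (A B : E →L[ℂ] E) : ℝ≥0∞ :=
  (‖A - B‖₊ : ℝ≥0∞) + hsNorm b (P ∘L (A - B) ∘L (1 - P))

/-- Hilbert–Schmidt norm of an operator between two spaces. -/
noncomputable def hsG {E F : Type*} [NormedAddCommGroup E] [InnerProductSpace ℂ E]
    [NormedAddCommGroup F] [InnerProductSpace ℂ F]
    {ι : Type*} (b : HilbertBasis ι ℂ E) (T : E →L[ℂ] F) : ℝ≥0∞ :=
  (∑' i : ι, (‖T (b i)‖₊ : ℝ≥0∞) ^ 2) ^ (1 / 2 : ℝ)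

section helpers

variable {E F G : Type*} [NormedAddCommGroup E] [InnerProductSpace ℂ E] [CompleteSpace E]
  [NormedAddCommGroup F] [InnerProductSpace ℂ F] [CompleteSpace F]
  [NormedAddCommGroup G] [InnerProductSpace ℂ G] [CompleteSpace G]
  {ι κ : Type*}

theorem hsNorm_eq_hsG (b : HilbertBasis ι ℂ E) (T : E →L[ℂ] E) : hsNorm b T = hsG b T := rfl

theorem parseval_enn (b : HilbertBasis ι ℂ E) (x : E) :
    ∑' i, (‖inner ℂ (b i) x‖₊ : ℝ≥0∞) ^ 2 = (‖x‖₊ : ℝ≥0∞) ^ 2 := by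
  have h := lp.hasSum_norm (p := 2) (by norm_num) (b.repr x)
  simp only [ENNReal.toReal_ofNat, Real.rpow_ofNat, LinearIsometryEquiv.norm_map,
    HilbertBasis.repr_apply_apply] at h
  have h2 : HasSum (fun i => ‖inner ℂ (b i) x‖₊ ^ 2) (‖x‖₊ ^ 2) := by
    rw [← NNReal.hasSum_coe]
    simpa using h
  have h3 := ENNReal.hasSum_coe.2 h2
  simpa using h3.tsum_eq

theorem hsG_adjoint (b : HilbertBasis ι ℂ E) (c : HilbertBasis κ ℂ F) (T : E →L[ℂ] F) :
    hsG b T = hsG c (ContinuousLinearMap.adjoint T) := by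
  unfold hsG
  congr 1
  simp_rw [← parseval_enn c (T _), ← parseval_enn b (ContinuousLinearMap.adjoint T _)]
  rw [ENNReal.tsum_comm]
  refine tsum_congr fun j => tsum_congr fun i => ?_
  rw [ContinuousLinearMap.adjoint_inner_right]
  congr 2
  ext
  exact norm_inner_symm _ _

theorem hsG_neg (b : HilbertBasis ι ℂ E) (T : E →L[ℂ] F) : hsG b (-T) = hsG b T := by
  simp [hsG]

theorem hsG_add_le (b : HilbertBasis ι ℂ E) (S T : E →L[ℂ] F) :
    hsG b (S + T) ≤ hsG b S + hsG b T := by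
  let _ : MeasurableSpace ι := ⊤
  have key := ENNReal.lintegral_Lp_add_le (p := 2) (μ := MeasureTheory.Measure.count)
    (f := fun i => (‖S (b i)‖₊ : ℝ≥0∞)) (g := fun i => (‖T (b i)‖₊ : ℝ≥0∞))
    (Measurable.aemeasurable (fun _ _ => trivial))
    (Measurable.aemeasurable (fun _ _ => trivial)) (by norm_num)
  simp only [MeasureTheory.lintegral_count, Pi.add_apply, ENNReal.rpow_ofNat] at key
  refine le_trans ?_ key
  unfold hsG
  refine ENNReal.rpow_le_rpow (ENNReal.tsum_le_tsum fun i => ?_) (by norm_num)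
  gcongr
  exact_mod_cast nnnorm_add_le _ _

theorem hsG_comp_left (b : HilbertBasis ι ℂ E) (R : F →L[ℂ] G) (T : E →L[ℂ] F) :
    hsG b (R ∘L T) ≤ ‖R‖₊ * hsG b T := by
  unfold hsG
  have : (‖R‖₊ : ℝ≥0∞) = ((‖R‖₊ : ℝ≥0∞) ^ 2) ^ (1 / 2 : ℝ) := by
    rw [← ENNReal.rpow_natCast, ← ENNReal.rpow_mul]; norm_num
  rw [this, ← ENNReal.mul_rpow_of_nonneg _ _ (by norm_num), ← ENNReal.tsum_mul_left]
  refine ENNReal.rpow_le_rpow (ENNReal.tsum_le_tsum fun i => ?_) (by norm_num)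
  rw [← mul_pow]
  gcongr
  exact_mod_cast R.le_opNNNorm _

theorem hsG_comp_right (b : HilbertBasis ι ℂ E) (b' : HilbertBasis κ ℂ G)
    (T : E →L[ℂ] F) (R : G →L[ℂ] E) :
    hsG b' (T ∘L R) ≤ ‖R‖₊ * hsG b T := by
  obtain ⟨w, c, -⟩ := exists_hilbertBasis ℂ F
  rw [hsG_adjoint b' c, hsG_adjoint b c, ContinuousLinearMap.adjoint_comp]
  refine (hsG_comp_left c _ _).trans ?_
  gcongr
  exact (LinearIsometryEquiv.nnnorm_map ContinuousLinearMap.adjoint R).le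

theorem nn_comp_le (R : F →L[ℂ] G) (T : E →L[ℂ] F) :
    (‖R ∘L T‖₊ : ℝ≥0∞) ≤ ‖R‖₊ * ‖T‖₊ := by
  exact_mod_cast ContinuousLinearMap.opNNNorm_comp_le R T

/-- One direction of the estimate. -/
theorem one_dir (b : HilbertBasis ι ℂ E) (c : HilbertBasis κ ℂ F) (e : E ≃L[ℂ] F)
    (P : E →L[ℂ] E) (Q : F →L[ℂ] F)
    (hHS : hsG c ((e : E →L[ℂ] F) ∘L P ∘L (e.symm : F →L[ℂ] E) - Q) < ⊤) :
    ∃ M : ℝ≥0∞, 1 ≤ M ∧ M < ⊤ ∧ ∀ X : E →L[ℂ] E,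
      (‖(e : E →L[ℂ] F) ∘L X ∘L (e.symm : F →L[ℂ] E)‖₊ : ℝ≥0∞) +
        hsG c (Q ∘L ((e : E →L[ℂ] F) ∘L X ∘L (e.symm : F →L[ℂ] E)) ∘L (1 - Q)) ≤
      M * (‖X‖₊ + hsG b (P ∘L X ∘L (1 - P))) := by
  set e' : E →L[ℂ] F := (e : E →L[ℂ] F) with he'
  set f' : F →L[ℂ] E := (e.symm : F →L[ℂ] E) with hf'
  have hfe : f' ∘L e' = 1 := by ext x; simp [he', hf']
  have hef : e' ∘L f' = 1 := by ext x; simp [he', hf']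
  set R := e' ∘L P ∘L f' with hR
  set D := R - Q with hD
  set a : ℝ≥0∞ := (‖e'‖₊ : ℝ≥0∞) * ‖f'‖₊ with ha
  set k : ℝ≥0∞ := a + (‖R‖₊ * a * hsG c D + ‖(1 - Q : F →L[ℂ] F)‖₊ * a * hsG c D) with hk
  have hatop : a < ⊤ := ENNReal.mul_lt_top ENNReal.coe_lt_top ENNReal.coe_lt_top
  refine ⟨1 + k, le_self_add, ?_, fun X => ?_⟩
  · simp only [hk, ENNReal.add_lt_top]
    refine ⟨ENNReal.one_lt_top, hatop, ?_, ?_⟩ <;>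
    exact ENNReal.mul_lt_top (ENNReal.mul_lt_top ENNReal.coe_lt_top hatop) hHS
  set Y := e' ∘L X ∘L f' with hY
  have hYn : (‖Y‖₊ : ℝ≥0∞) ≤ a * ‖X‖₊ := by
    calc (‖Y‖₊ : ℝ≥0∞) ≤ ‖e'‖₊ * (‖X‖₊ * ‖f'‖₊) :=
          (nn_comp_le _ _).trans (by gcongr; exact nn_comp_le _ _)
      _ = a * ‖X‖₊ := by rw [ha]; ring
  have hdec : Q ∘L Y ∘L (1 - Q) =
      e' ∘L ((P ∘L X ∘L (1 - P)) ∘L f') + ((R ∘L Y) ∘L D + -(D ∘L (Y ∘L (1 - Q)))) := by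
    ext x
    have h1 : ∀ y, f' (e' y) = y := fun y => by simp [he', hf']
    have h2 : ∀ y, e' (f' y) = y := fun y => by simp [he', hf']
    simp only [hD, hR, hY, ContinuousLinearMap.comp_apply, ContinuousLinearMap.add_apply,
      ContinuousLinearMap.sub_apply, ContinuousLinearMap.neg_apply,
      ContinuousLinearMap.one_apply, map_sub, h1, h2]
    abel
  have t1 : hsG c (e' ∘L ((P ∘L X ∘L (1 - P)) ∘L f')) ≤ a * hsG b (P ∘L X ∘L (1 - P)) := by
    calc _ ≤ ‖e'‖₊ * (‖f'‖₊ * hsG b (P ∘L X ∘L (1 - P))) :=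
          (hsG_comp_left _ _ _).trans (by gcongr; exact hsG_comp_right b c _ _)
      _ = _ := by rw [ha]; ring
  have t2 : hsG c ((R ∘L Y) ∘L D) ≤ ‖R‖₊ * a * hsG c D * ‖X‖₊ := by
    calc _ ≤ ‖R‖₊ * (a * ‖X‖₊) * hsG c D :=
          (hsG_comp_left _ _ _).trans (by
            gcongr; exact (nn_comp_le _ _).trans (by gcongr))
      _ = _ := by ring
  have t3 : hsG c (-(D ∘L (Y ∘L (1 - Q)))) ≤
      ‖(1 - Q : F →L[ℂ] F)‖₊ * a * hsG c D * ‖X‖₊ := by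
    rw [hsG_neg]
    calc _ ≤ (a * ‖X‖₊ * ‖(1 - Q : F →L[ℂ] F)‖₊) * hsG c D :=
          (hsG_comp_right c c _ _).trans (by
            gcongr; exact (nn_comp_le _ _).trans (by gcongr))
      _ = _ := by ring
  rw [hdec]
  set H := hsG b (P ∘L X ∘L (1 - P))
  set s := ‖R‖₊ * a * hsG c D
  set t := ‖(1 - Q : F →L[ℂ] F)‖₊ * a * hsG c D
  calc _ ≤ a * ‖X‖₊ + (a * H + (s * ‖X‖₊ + t * ‖X‖₊)) := by
        refine add_le_add hYn ((hsG_add_le _ _ _).trans (add_le_add t1 ?_))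
        exact (hsG_add_le _ _ _).trans (add_le_add t2 t3)
    _ ≤ (a * ‖X‖₊ + (a * H + (s * ‖X‖₊ + t * ‖X‖₊))) + (‖X‖₊ + H + s * H + t * H) :=
        le_self_add
    _ = (1 + k) * (‖X‖₊ + H) := by rw [hk]; ring

end helpers

/-- **Equivalence of the metrics `d_{P₁}` and `d_{P₂}`, hence `Sp(∞,P₁) = Sp(∞,P₂) `
as topological groups.**  The two Hilbert structures on the "same" space `K` are
modelled by two complex Hilbert spaces `E₁`, `E₂` identified by a linear
homeomorphism `e` with `α ‖f‖₁ ≤ ‖e f‖₂ ≤ β ‖f‖₁` (equivalence of the norms);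
an operator `A` on `(K, ⟨,⟩₁)` corresponds to `e A e⁻¹` on `(K, ⟨,⟩₂)`.
`P₁`, `P₂` are idempotents, self-adjoint for the respective inner products, with
`P₁ - P₂` Hilbert–Schmidt.  Then `d_{P₂}` is equivalent to `d_{P₁}`
(`m d_{P₁} ≤ d_{P₂} ≤ M d_{P₁}`), and `P₁ U (1 - P₁)` is Hilbert–Schmidt iff
`P₂ U (1 - P₂)` is. -/
theorem dP_equivalent_of_norm_equivalent_and_HS
    {E₁ E₂ : Type*}
    [NormedAddCommGroup E₁] [InnerProductSpace ℂ E₁] [CompleteSpace E₁]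
    [NormedAddCommGroup E₂] [InnerProductSpace ℂ E₂] [CompleteSpace E₂]
    {ι₁ ι₂ : Type*} (b₁ : HilbertBasis ι₁ ℂ E₁) (b₂ : HilbertBasis ι₂ ℂ E₂)
    (e : E₁ ≃L[ℂ] E₂) (α β : ℝ) (hα : 0 < α) (hαβ : α ≤ β)
    (hlow : ∀ f : E₁, α * ‖f‖ ≤ ‖e f‖) (hup : ∀ f : E₁, ‖e f‖ ≤ β * ‖f‖)
    (P₁ : E₁ →L[ℂ] E₁) (hP₁i : IsIdempotentElem P₁) (hP₁s : IsSelfAdjoint P₁)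
    (P₂ : E₂ →L[ℂ] E₂) (hP₂i : IsIdempotentElem P₂) (hP₂s : IsSelfAdjoint P₂)
    (hHS : hsNorm b₂ ((e : E₁ →L[ℂ] E₂) ∘L P₁ ∘L (e.symm : E₂ →L[ℂ] E₁) - P₂) < ⊤) :
    ∃ m M : ℝ≥0∞, 0 < m ∧ m ≤ M ∧ M < ⊤ ∧
      (∀ A B : E₁ →L[ℂ] E₁,
        m * dP b₁ P₁ A B ≤
            dP b₂ P₂ ((e : E₁ →L[ℂ] E₂) ∘L A ∘L (e.symm : E₂ →L[ℂ] E₁))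
              ((e : E₁ →L[ℂ] E₂) ∘L B ∘L (e.symm : E₂ →L[ℂ] E₁)) ∧
          dP b₂ P₂ ((e : E₁ →L[ℂ] E₂) ∘L A ∘L (e.symm : E₂ →L[ℂ] E₁))
              ((e : E₁ →L[ℂ] E₂) ∘L B ∘L (e.symm : E₂ →L[ℂ] E₁)) ≤
            M * dP b₁ P₁ A B) ∧
      (∀ U : E₁ →L[ℂ] E₁,
        hsNorm b₁ (P₁ ∘L U ∘L (1 - P₁)) < ⊤ ↔
          hsNorm b₂ (P₂ ∘L ((e : E₁ →L[ℂ] E₂) ∘L U ∘L (e.symm : E₂ →L[ℂ] E₁))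
            ∘L (1 - P₂)) < ⊤) := by
  obtain ⟨M, hM1, hMt, hM⟩ := one_dir b₁ b₂ e P₁ P₂ hHS
  have hHS' : hsG b₁ ((e.symm : E₂ →L[ℂ] E₁) ∘L P₂ ∘L (e.symm.symm : E₁ →L[ℂ] E₂) - P₁) < ⊤ := by
    have h : (e.symm : E₂ →L[ℂ] E₁) ∘L P₂ ∘L (e.symm.symm : E₁ →L[ℂ] E₂) - P₁ =
        -((e.symm : E₂ →L[ℂ] E₁) ∘L
          (((e : E₁ →L[ℂ] E₂) ∘L P₁ ∘L (e.symm : E₂ →L[ℂ] E₁) - P₂) ∘L (e : E₁ →L[ℂ] E₂))) := by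
      ext x; simp
    rw [h, hsG_neg]
    refine (hsG_comp_left _ _ _).trans_lt (ENNReal.mul_lt_top ENNReal.coe_lt_top ?_)
    exact (hsG_comp_right b₂ b₁ _ _).trans_lt (ENNReal.mul_lt_top ENNReal.coe_lt_top hHS)
  obtain ⟨N, hN1, hNt, hN⟩ := one_dir b₂ b₁ e.symm P₂ P₁ hHS'
  have hN' : ∀ X : E₁ →L[ℂ] E₁, (‖X‖₊ : ℝ≥0∞) + hsG b₁ (P₁ ∘L X ∘L (1 - P₁)) ≤
      N * (‖(e : E₁ →L[ℂ] E₂) ∘L X ∘L (e.symm : E₂ →L[ℂ] E₁)‖₊ +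
        hsG b₂ (P₂ ∘L ((e : E₁ →L[ℂ] E₂) ∘L X ∘L (e.symm : E₂ →L[ℂ] E₁)) ∘L (1 - P₂))) := by
    intro X
    have h := hN ((e : E₁ →L[ℂ] E₂) ∘L X ∘L (e.symm : E₂ →L[ℂ] E₁))
    have hX : (e.symm : E₂ →L[ℂ] E₁) ∘L ((e : E₁ →L[ℂ] E₂) ∘L X ∘L (e.symm : E₂ →L[ℂ] E₁)) ∘L
        (e.symm.symm : E₁ →L[ℂ] E₂) = X := by
      ext x; simp
    rwa [hX] at h
  have hsub : ∀ A B : E₁ →L[ℂ] E₁, (e : E₁ →L[ℂ] E₂) ∘L A ∘L (e.symm : E₂ →L[ℂ] E₁) -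
      (e : E₁ →L[ℂ] E₂) ∘L B ∘L (e.symm : E₂ →L[ℂ] E₁) =
      (e : E₁ →L[ℂ] E₂) ∘L (A - B) ∘L (e.symm : E₂ →L[ℂ] E₁) := by
    intro A B; ext x; simp
  have hN0 : N ≠ 0 := (zero_lt_one.trans_le hN1).ne'
  refine ⟨N⁻¹, M, ENNReal.inv_pos.2 hNt.ne, (ENNReal.inv_le_one.2 hN1).trans hM1, hMt, ?_, ?_⟩
  · intro A B
    unfold dP
    rw [hsub]
    refine ⟨?_, hM (A - B)⟩
    rw [mul_comm, ← div_eq_mul_inv]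
    exact ENNReal.div_le_of_le_mul' (hN' (A - B))
  · intro U
    constructor
    · intro h
      exact (le_add_self.trans (hM U)).trans_lt
        (ENNReal.mul_lt_top hMt (ENNReal.add_lt_top.2 ⟨ENNReal.coe_lt_top, h⟩))
    · intro h
      exact (le_add_self.trans (hN' U)).trans_lt
        (ENNReal.mul_lt_top hNt (ENNReal.add_lt_top.2 ⟨ENNReal.coe_lt_top, h⟩))
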